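/- arXiv:1904.13104 — 6 statements merged into one kernel-verified Lean document; each statement's English description precedes it below -/
import Mathlib

section
/- $S$ satisfies the homogeneous Neumann condition on both faces of the crack $\{(\sigma,0):\sigma\le 0\}$: for every $\sigma<0$ one has $\lim_{h\to 0^+}\partial_2 S(\sigma,h)=0$ and $\lim_{h\to 0^-}\partial_2 S(\sigma,h)=0$. -/
open Filter

/-- The plane with the closed nonpositive `x₁`-axis removed. -/
def P : Set (ℝ × ℝ) := {x | x.2 ≠ 0 ∨ 0 < x.1}

/-- `S(x₁,x₂) = (1/√2) · x₂ / √(|x| + x₁)` where `|x| = √(x₁² + x₂²)`. -/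
noncomputable def S : ℝ × ℝ → ℝ := fun x =>
  (1 / Real.sqrt 2) * (x.2 / Real.sqrt (Real.sqrt (x.1 ^ 2 + x.2 ^ 2) + x.1))

/-- Away from the axis, `S` is `± √(|x| - x₁) / √2`, with the sign of `x₂`. -/
lemma S_eq_of_mul_pos {ε : ℝ} (hε : |ε| = 1) {x : ℝ × ℝ} (hx : 0 < ε * x.2) :
    S x = ε * ((1 / √2) * √(√(x.1 ^ 2 + x.2 ^ 2) - x.1)) := by
  have hx2 : x.2 ≠ 0 := right_ne_zero_of_mul hx.ne'
  have hlt : |x.1| < √(x.1 ^ 2 + x.2 ^ 2) := by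
    rw [← Real.sqrt_sq_eq_abs]
    exact Real.sqrt_lt_sqrt (sq_nonneg _) (lt_add_of_pos_right _ (by positivity))
  obtain ⟨h1, h2⟩ := abs_lt.1 hlt
  have hεε : ε * ε = 1 := by rw [← abs_mul_abs_self, hε, one_mul]
  have hs : √(x.1 ^ 2 + x.2 ^ 2) ^ 2 = x.1 ^ 2 + x.2 ^ 2 := Real.sq_sqrt (by positivity)
  have key : √(√(x.1 ^ 2 + x.2 ^ 2) - x.1) * √(√(x.1 ^ 2 + x.2 ^ 2) + x.1) = ε * x.2 := by
    rw [← Real.sqrt_mul (by linarith), Real.sqrt_eq_iff_mul_self_eq (by nlinarith) hx.le]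
    linear_combination hs - x.2 ^ 2 * hεε
  have hpos : 0 < √(√(x.1 ^ 2 + x.2 ^ 2) + x.1) := Real.sqrt_pos.2 (by linarith)
  have hdiv : x.2 / √(√(x.1 ^ 2 + x.2 ^ 2) + x.1) = ε * √(√(x.1 ^ 2 + x.2 ^ 2) - x.1) := by
    rw [div_eq_iff hpos.ne', mul_assoc, key, ← mul_assoc, hεε, one_mul]
  rw [S, hdiv]
  ring

lemma fderiv_S_of_mul_pos {ε σ h : ℝ} (hε : |ε| = 1) (hσ : σ < 0) (hh : 0 < ε * h) :
    fderiv ℝ S (σ, h) (0, 1) =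
      ε * ((1 / √2) * (2 * h / (2 * √(σ ^ 2 + h ^ 2)) / (2 * √(√(σ ^ 2 + h ^ 2) - σ)))) := by
  have hr : σ ^ 2 + h ^ 2 ≠ 0 := by have := sq_pos_of_neg hσ; positivity
  have hd : √(σ ^ 2 + h ^ 2) - σ ≠ 0 := by
    have := Real.sqrt_nonneg (σ ^ 2 + h ^ 2)
    linarith
  let G : ℝ × ℝ → ℝ := fun x => ε * ((1 / √2) * √(√(x.1 ^ 2 + x.2 ^ 2) - x.1))
  have hSG : S =ᶠ[nhds (σ, h)] G := by
    have : ∀ᶠ x : ℝ × ℝ in nhds (σ, h), 0 < ε * x.2 :=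
      (continuous_const.mul continuous_snd).continuousAt.eventually (lt_mem_nhds hh)
    filter_upwards [this] with x hx using S_eq_of_mul_pos hε hx
  have hG : DifferentiableAt ℝ G (σ, h) := by
    have h1 : DifferentiableAt ℝ (fun x : ℝ × ℝ => √(x.1 ^ 2 + x.2 ^ 2)) (σ, h) :=
      DifferentiableAt.sqrt (by fun_prop) hr
    have h2 : DifferentiableAt ℝ (fun x : ℝ × ℝ => √(√(x.1 ^ 2 + x.2 ^ 2) - x.1)) (σ, h) :=
      DifferentiableAt.sqrt (h1.sub differentiableAt_fst) hd
    exact (h2.const_mul _).const_mul _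
  have hline : HasDerivAt (fun t : ℝ => (σ, t)) ((0 : ℝ), (1 : ℝ)) h :=
    (hasDerivAt_const h σ).prodMk (hasDerivAt_id h)
  have hcomp := hG.hasFDerivAt.comp_hasDerivAt h hline
  have hsq : HasDerivAt (fun t : ℝ => σ ^ 2 + t ^ 2) (2 * h) h := by
    simpa using (hasDerivAt_pow 2 h).const_add (σ ^ 2)
  have hexp := ((((hsq.sqrt hr).sub_const σ).sqrt hd).const_mul (1 / √2)).const_mul ε
  rw [hSG.fderiv_eq]
  exact hcomp.unique hexp

lemma tendsto_fderiv_S {ε σ : ℝ} (hε : |ε| = 1) (hσ : σ < 0) :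
    Tendsto (fun h : ℝ => fderiv ℝ S (σ, h) (0, 1))
      (nhdsWithin 0 {h | 0 < ε * h}) (nhds 0) := by
  have hc : ContinuousAt (fun h : ℝ => ε * ((1 / √2) *
      (2 * h / (2 * √(σ ^ 2 + h ^ 2)) / (2 * √(√(σ ^ 2 + h ^ 2) - σ))))) 0 := by
    have h1 : 2 * √(σ ^ 2 + (0 : ℝ) ^ 2) ≠ 0 := by
      have := sq_pos_of_neg hσ
      positivity
    have h2 : 2 * √(√(σ ^ 2 + (0 : ℝ) ^ 2) - σ) ≠ 0 := by
      have : 0 < √(σ ^ 2 + (0 : ℝ) ^ 2) - σ := by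
        have := Real.sqrt_nonneg (σ ^ 2 + (0 : ℝ) ^ 2)
        linarith
      positivity
    fun_prop (disch := assumption)
  have h0 := hc.tendsto
  simp only [mul_zero, zero_div] at h0
  refine (h0.mono_left nhdsWithin_le_nhds).congr' ?_
  filter_upwards [self_mem_nhdsWithin] with h hh using (fderiv_S_of_mul_pos hε hσ hh).symm

/-- Homogeneous Neumann condition on both faces of the crack `{(σ,0) : σ ≤ 0}`:
for every `σ < 0`, `∂₂S(σ,h) → 0` as `h → 0⁺` and as `h → 0⁻`. -/
theorem S_neumann_on_crack :
    ∀ σ : ℝ, σ < 0 →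
      Tendsto (fun h : ℝ => fderiv ℝ S (σ, h) (0, 1)) (nhdsWithin 0 (Set.Ioi 0)) (nhds 0) ∧
      Tendsto (fun h : ℝ => fderiv ℝ S (σ, h) (0, 1)) (nhdsWithin 0 (Set.Iio 0)) (nhds 0) := by
  intro σ hσ
  constructor
  · simpa [Set.Ioi] using tendsto_fderiv_S (ε := 1) (by simp) hσ
  · simpa [Set.Iio] using tendsto_fderiv_S (ε := -1) (by simp) hσ
end

section
/- For every $R>0$ the function $x\mapsto\|\nabla S(x)\|^2$ is integrable on the cracked ball $B_R\setminus\{(\sigma,0):\sigma\le 0\}$, where $B_R:=\{x\in\mathbb{R}^2:|x|<R\}$, and $\int_{B_R\setminus\{(\sigma,0):\sigma\le 0\}}\|\nabla S(x)\|^2\,dx=\frac{\pi R}{2}$. In particular $S$ has square-integrable gradient on every bounded cracked domain (the $H^1$ membership of $S$). -/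
open MeasureTheory

/-- The open Euclidean ball of radius `R` centered at the origin. -/
def ball (R : ℝ) : Set (ℝ × ℝ) := {x | Real.sqrt (x.1 ^ 2 + x.2 ^ 2) < R}

/-- The crack `{(σ,0) : σ ≤ 0}`. -/
def crack : Set (ℝ × ℝ) := {x | x.2 = 0 ∧ x.1 ≤ 0}

lemma measurableSet_ball_diff_crack (R : ℝ) : MeasurableSet (ball R \ crack) := by
  refine MeasurableSet.diff (measurableSet_lt (by fun_prop) measurable_const) ?_
  exact (measurableSet_eq_fun measurable_snd measurable_const).inter
    (measurableSet_le measurable_fst measurable_const)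

lemma mem_P_of_notMem_crack {x : ℝ × ℝ} (hx : x ∉ crack) : x ∈ P := by
  by_contra h
  simp only [P, Set.mem_ofPred_eq, not_or, not_not, not_lt] at h
  exact hx h

lemma norm_pos_of_mem_P {x : ℝ × ℝ} (hx : x ∈ P) : 0 < √(x.1 ^ 2 + x.2 ^ 2) := by
  rcases hx with h | h <;> positivity

lemma norm_add_fst_pos_of_mem_P {x : ℝ × ℝ} (hx : x ∈ P) :
    0 < √(x.1 ^ 2 + x.2 ^ 2) + x.1 := by
  have hr := norm_pos_of_mem_P hx
  have hsq : √(x.1 ^ 2 + x.2 ^ 2) ^ 2 = x.1 ^ 2 + x.2 ^ 2 := Real.sq_sqrt (by positivity)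
  rcases hx with h | h
  · have : 0 < x.2 ^ 2 := by positivity
    nlinarith
  · linarith

lemma fderiv_S_sq_add_sq {x : ℝ × ℝ} (hx : x ∈ P) :
    (fderiv ℝ S x (1, 0)) ^ 2 + (fderiv ℝ S x (0, 1)) ^ 2 =
      (4 * √(x.1 ^ 2 + x.2 ^ 2))⁻¹ := by
  have hr := norm_pos_of_mem_P hx
  have hu := norm_add_fst_pos_of_mem_P hx
  have hsq : √(x.1 ^ 2 + x.2 ^ 2) ^ 2 = x.1 ^ 2 + x.2 ^ 2 := Real.sq_sqrt (by positivity)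
  have hfst : HasFDerivAt Prod.fst (ContinuousLinearMap.fst ℝ ℝ ℝ) x := hasFDerivAt_fst
  have hsnd : HasFDerivAt Prod.snd (ContinuousLinearMap.snd ℝ ℝ ℝ) x := hasFDerivAt_snd
  have hnorm := ((hfst.pow 2).add (hsnd.pow 2)).sqrt (Real.sqrt_pos.1 hr).ne'
  have hden := (hnorm.add hfst).sqrt hu.ne'
  have hinv := (hasDerivAt_inv (Real.sqrt_pos.2 hu).ne').comp_hasFDerivAt x hden
  have hS : HasFDerivAt S _ x := (hsnd.mul hinv).const_mul (1 / √2)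
  rw [hS.fderiv]
  have htwo : √2 ^ 2 = (2 : ℝ) := Real.sq_sqrt (by norm_num)
  have hssq := Real.sq_sqrt hu.le
  have hs := Real.sqrt_pos.2 hu
  simp
  generalize √(√(x.1 ^ 2 + x.2 ^ 2) + x.1) = s at *
  generalize √(x.1 ^ 2 + x.2 ^ 2) = r at *
  field_simp
  have hx1 : x.1 = s ^ 2 - r := by linarith
  have hx2 : x.2 ^ 2 = s ^ 2 * (2 * r - s ^ 2) := by rw [hx1] at hsq; linear_combination -hsq
  rw [htwo, hx2, hx1]
  ring

lemma lintegral_inv_norm_ball_diff_crack {R : ℝ} (hR : 0 < R) :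
    ∫⁻ x in ball R \ crack, ENNReal.ofReal (4 * √(x.1 ^ 2 + x.2 ^ 2))⁻¹ =
      ENNReal.ofReal (Real.pi * R / 2) := by
  have hmeas : MeasurableSet (ball R \ crack) := measurableSet_ball_diff_crack R
  rw [← lintegral_indicator hmeas, ← lintegral_comp_polarCoord_symm]
  have hcongr : ∀ p ∈ polarCoord.target, ENNReal.ofReal p.1 •
      (ball R \ crack).indicator
        (fun x => ENNReal.ofReal (4 * √(x.1 ^ 2 + x.2 ^ 2))⁻¹) (polarCoord.symm p) =
      (Set.Iio R ×ˢ Set.univ).indicator (fun _ => ENNReal.ofReal 4⁻¹) p := by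
    intro p hp
    have hp1 : 0 < p.1 := hp.1
    have hcrack : polarCoord.symm p ∉ crack := by
      rintro ⟨h2, h1⟩
      rcases polarCoord.map_target hp with h | h
      · exact absurd h1 (not_le.2 h)
      · exact h h2
    have hnorm : √((polarCoord.symm p).1 ^ 2 + (polarCoord.symm p).2 ^ 2) = p.1 := by
      rw [polarCoord_symm_apply, ← Real.sqrt_sq hp1.le]
      congr 1
      simp only [Real.sqrt_sq hp1.le]
      linear_combination p.1 ^ 2 * Real.sin_sq_add_cos_sq p.2
    by_cases h : p.1 < R
    · rw [Set.indicator_of_mem (show polarCoord.symm p ∈ ball R \ crack from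
        ⟨hnorm.trans_lt h, hcrack⟩), Set.indicator_of_mem (by exact ⟨h, trivial⟩), hnorm,
        smul_eq_mul, ← ENNReal.ofReal_mul hp1.le]
      congr 1
      field_simp
    · rw [Set.indicator_of_notMem (fun hb => h (hnorm.symm.trans_lt hb.1)),
        Set.indicator_of_notMem (fun hb => h hb.1), smul_zero]
  rw [setLIntegral_congr_fun polarCoord.open_target.measurableSet hcongr,
    setLIntegral_indicator (measurableSet_Iio.prod MeasurableSet.univ), setLIntegral_const,
    polarCoord_target, Set.prod_inter_prod, Set.univ_inter, Set.Iio_inter_Ioi,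
    Measure.volume_eq_prod, Measure.prod_prod, Real.volume_Ioo, Real.volume_Ioo,
    ← ENNReal.ofReal_mul (by linarith), ← ENNReal.ofReal_mul (by norm_num)]
  congr 1
  ring

/-- For every `R > 0`, `‖∇S‖²` is integrable on the cracked ball `B_R \ crack` and
`∫_{B_R \ crack} ‖∇S‖² dx = πR/2`. -/
theorem S_gradient_sq_integral :
    ∀ R : ℝ, 0 < R →
      IntegrableOn (fun x => (fderiv ℝ S x (1, 0)) ^ 2 + (fderiv ℝ S x (0, 1)) ^ 2)
        (ball R \ crack) volume ∧
      ∫ x in ball R \ crack, ((fderiv ℝ S x (1, 0)) ^ 2 + (fderiv ℝ S x (0, 1)) ^ 2) =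
        Real.pi * R / 2 := by
  intro R hR
  have hmeas := measurableSet_ball_diff_crack R
  have hcongr : Set.EqOn
      (fun x : ℝ × ℝ => (fderiv ℝ S x (1, 0)) ^ 2 + (fderiv ℝ S x (0, 1)) ^ 2)
      (fun x => (4 * √(x.1 ^ 2 + x.2 ^ 2))⁻¹) (ball R \ crack) :=
    fun x hx => fderiv_S_sq_add_sq (mem_P_of_notMem_crack hx.2)
  rw [integrableOn_congr_fun hcongr hmeas, setIntegral_congr_fun hmeas hcongr]
  have hlint := lintegral_inv_norm_ball_diff_crack hR
  have hnonneg : ∀ x : ℝ × ℝ, 0 ≤ (4 * √(x.1 ^ 2 + x.2 ^ 2))⁻¹ := fun x => by positivity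
  have haesm : AEStronglyMeasurable (fun x : ℝ × ℝ => (4 * √(x.1 ^ 2 + x.2 ^ 2))⁻¹)
      (volume.restrict (ball R \ crack)) :=
    Measurable.aestronglyMeasurable (by fun_prop)
  refine ⟨⟨haesm, ?_⟩, ?_⟩
  · rw [hasFiniteIntegral_iff_ofReal (.of_forall hnonneg), hlint]
    exact ENNReal.ofReal_lt_top
  · rw [integral_eq_lintegral_of_nonneg_ae (.of_forall hnonneg) haesm, hlint,
      ENNReal.toReal_ofReal (by positivity)]
end

section
/- $S$ is a weak solution of the Laplace equation with homogeneous Neumann condition on the crack: for every $R>0$ and every smooth compactly supported test function $\varphi:\mathbb{R}^2\to\mathbb{R}$ with support contained in $B_R:=\{x\in\mathbb{R}^2:|x|<R\}$ (NOT required to vanish on the crack $\{(\sigma,0):\sigma\le 0\}$), one has $\int_{B_R\setminus\{(\sigma,0):\sigma\le 0\}}\nabla S(x)\cdot\nabla\varphi(x)\,dx=0$. -/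
open MeasureTheory

open Set

/-- The complex squaring map `(u, v) ↦ (u² - v², 2uv)` in real coordinates. It maps the right
half-plane bijectively onto the complement of the crack, and pulls `S` back to `v`. -/
def sqMap (w : ℝ × ℝ) : ℝ × ℝ := (w.1 ^ 2 - w.2 ^ 2, 2 * w.1 * w.2)

/-- The derivative of `sqMap`. -/
noncomputable def sqMapDeriv (w : ℝ × ℝ) : ℝ × ℝ →L[ℝ] ℝ × ℝ :=
  (Matrix.toLin (.finTwoProd ℝ) (.finTwoProd ℝ)
    !![2 * w.1, -(2 * w.2); 2 * w.2, 2 * w.1]).toContinuousLinearMap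

lemma sqMapDeriv_apply (w h : ℝ × ℝ) :
    sqMapDeriv w h = (2 * w.1 * h.1 - 2 * w.2 * h.2, 2 * w.2 * h.1 + 2 * w.1 * h.2) := by
  rw [sqMapDeriv, Matrix.toLin_finTwoProd_toContinuousLinearMap]
  ext <;> simp
  ring

lemma det_sqMapDeriv (w : ℝ × ℝ) : (sqMapDeriv w).det = 4 * (w.1 ^ 2 + w.2 ^ 2) := by
  rw [sqMapDeriv, LinearMap.det_toContinuousLinearMap, LinearMap.det_toLin, Matrix.det_fin_two_of]
  ring

lemma contDiff_sqMap : ContDiff ℝ (⊤ : ℕ∞) sqMap := by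
  unfold sqMap
  fun_prop

lemma hasFDerivAt_sqMap (w : ℝ × ℝ) : HasFDerivAt sqMap (sqMapDeriv w) w := by
  have h := ((hasFDerivAt_fst (𝕜 := ℝ) (p := w)).pow 2 |>.sub
      ((hasFDerivAt_snd (𝕜 := ℝ) (p := w)).pow 2)).prodMk
    ((hasFDerivAt_fst (𝕜 := ℝ) (p := w)).const_mul 2 |>.mul (hasFDerivAt_snd (𝕜 := ℝ) (p := w)))
  refine h.congr_fderiv (ContinuousLinearMap.ext fun x => ?_)
  rw [sqMapDeriv_apply]
  ext <;> simp
  ring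

lemma sqrt_sqMap (w : ℝ × ℝ) :
    Real.sqrt ((sqMap w).1 ^ 2 + (sqMap w).2 ^ 2) = w.1 ^ 2 + w.2 ^ 2 := by
  rw [← Real.sqrt_sq (by positivity : 0 ≤ w.1 ^ 2 + w.2 ^ 2)]
  congr 1
  simp only [sqMap]
  ring

lemma injOn_sqMap : InjOn sqMap (Ioi 0 ×ˢ univ) := by
  rintro ⟨u, v⟩ hu ⟨u', v'⟩ hu' h
  have hn : u ^ 2 + v ^ 2 = u' ^ 2 + v' ^ 2 := by
    simpa only [h, sqrt_sqMap] using (sqrt_sqMap (u, v)).symm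
  simp only [sqMap, Prod.mk.injEq] at h
  simp only [mem_prod, mem_Ioi, mem_univ, and_true] at hu hu'
  obtain rfl : u = u' := (sq_eq_sq₀ hu.le hu'.le).1 (by linarith [h.1])
  exact Prod.ext rfl (mul_left_cancel₀ (by positivity) h.2)

lemma image_sqMap : sqMap '' (Ioi 0 ×ˢ univ) = crackᶜ := by
  ext ⟨x, y⟩
  constructor
  · rintro ⟨⟨u, v⟩, hu, h⟩ ⟨hy, hx⟩
    simp only [sqMap, Prod.mk.injEq] at h
    simp only [mem_prod, mem_Ioi, mem_univ, and_true] at hu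
    obtain rfl : v = 0 := by
      have : 2 * u * v = 0 := h.2.trans hy
      simpa [hu.ne'] using this
    have : u ^ 2 - 0 ^ 2 ≤ 0 := h.1.trans_le hx
    nlinarith
  · intro h
    have hr : Real.sqrt (x ^ 2 + y ^ 2) ^ 2 = x ^ 2 + y ^ 2 := Real.sq_sqrt (by positivity)
    have hr0 := Real.sqrt_nonneg (x ^ 2 + y ^ 2)
    set r := Real.sqrt (x ^ 2 + y ^ 2)
    have hpos : 0 < (r + x) / 2 := by
      by_contra! hle
      have hy : y = 0 := by
        have : y ^ 2 ≤ 0 := by nlinarith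
        exact pow_eq_zero_iff two_ne_zero |>.1 (le_antisymm this (sq_nonneg y))
      exact h ⟨hy, by change x ≤ 0; linarith⟩
    have hu := Real.sqrt_pos.2 hpos
    have hu2 := Real.sq_sqrt hpos.le
    set u := Real.sqrt ((r + x) / 2)
    refine ⟨(u, y / (2 * u)), ⟨hu, mem_univ _⟩, Prod.ext ?_ ?_⟩
    · simp only [sqMap, div_pow, mul_pow, hu2]
      have : r + x ≠ 0 := by linarith
      field_simp
      linear_combination hr
    · simp only [sqMap]
      field_simp

lemma S_sqMap {w : ℝ × ℝ} (hw : 0 < w.1) : S (sqMap w) = w.2 := by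
  have h : w.1 ^ 2 + w.2 ^ 2 + (sqMap w).1 = 2 * w.1 ^ 2 := by
    simp only [sqMap]
    ring
  rw [S, sqrt_sqMap, h, Real.sqrt_mul zero_le_two, Real.sqrt_sq hw.le]
  simp only [sqMap]
  field_simp
  rw [Real.sq_sqrt zero_le_two]

lemma differentiableAt_S_sqMap {w : ℝ × ℝ} (hw : 0 < w.1) : DifferentiableAt ℝ S (sqMap w) := by
  have hr : (sqMap w).1 ^ 2 + (sqMap w).2 ^ 2 ≠ 0 := by
    refine (Real.sqrt_ne_zero'.1 ?_).ne'
    rw [sqrt_sqMap]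
    positivity
  have hpos : 0 < Real.sqrt ((sqMap w).1 ^ 2 + (sqMap w).2 ^ 2) + (sqMap w).1 := by
    rw [sqrt_sqMap]
    simp only [sqMap]
    nlinarith
  have hs := (Real.sqrt_pos.2 hpos).ne'
  have hne := hpos.ne'
  unfold S
  fun_prop (disch := assumption)

/-- For any `φ`, the Dirichlet product of `S` and `φ` pulls back under `sqMap` to the
vertical derivative of `φ ∘ sqMap`. -/
lemma det_mul_gradient_product {φ : ℝ × ℝ → ℝ} {w : ℝ × ℝ} (hw : 0 < w.1)
    (hφ : DifferentiableAt ℝ φ (sqMap w)) :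
    |(sqMapDeriv w).det| • (fderiv ℝ S (sqMap w) (1, 0) * fderiv ℝ φ (sqMap w) (1, 0) +
      fderiv ℝ S (sqMap w) (0, 1) * fderiv ℝ φ (sqMap w) (0, 1)) =
    fderiv ℝ (φ ∘ sqMap) w (0, 1) := by
  have expand (L : ℝ × ℝ →L[ℝ] ℝ) (a b : ℝ) : L (a, b) = a * L (1, 0) + b * L (0, 1) := by
    rw [← smul_eq_mul, ← smul_eq_mul, ← map_smul, ← map_smul, ← map_add]
    simp
  have hS : fderiv ℝ S (sqMap w) ∘L sqMapDeriv w = ContinuousLinearMap.snd ℝ ℝ ℝ := by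
    refine ((differentiableAt_S_sqMap hw).hasFDerivAt.comp w (hasFDerivAt_sqMap w)).unique ?_
    refine hasFDerivAt_snd.congr_of_eventuallyEq ?_
    filter_upwards [continuous_fst.continuousAt.eventually (lt_mem_nhds hw)] with z hz
    exact S_sqMap hz
  have h₁ := DFunLike.congr_fun hS (1, 0)
  have h₂ := DFunLike.congr_fun hS (0, 1)
  rw [(hφ.hasFDerivAt.comp w (hasFDerivAt_sqMap w)).fderiv, det_sqMapDeriv,
    abs_of_nonneg (by positivity), smul_eq_mul]
  simp only [ContinuousLinearMap.comp_apply, sqMapDeriv_apply, ContinuousLinearMap.coe_snd',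
    mul_one, mul_zero, sub_zero, zero_sub, add_zero, zero_add] at h₁ h₂ ⊢
  rw [expand] at h₁ h₂
  rw [expand _ (-(2 * w.2))]
  set a := fderiv ℝ S (sqMap w) (1, 0)
  set b := fderiv ℝ S (sqMap w) (0, 1)
  set p := fderiv ℝ φ (sqMap w) (1, 0)
  set q := fderiv ℝ φ (sqMap w) (0, 1)
  linear_combination (2 * w.1 * p + 2 * w.2 * q) * h₁ + (2 * w.1 * q - 2 * w.2 * p) * h₂

lemma hasCompactSupport_comp_sqMap {φ : ℝ × ℝ → ℝ} {R : ℝ} (hφ : tsupport φ ⊆ ball R) :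
    HasCompactSupport (φ ∘ sqMap) := by
  refine HasCompactSupport.of_support_subset_isCompact
    (isCompact_closedBall (0 : ℝ × ℝ) (Real.sqrt R)) fun w hw => ?_
  have h : w.1 ^ 2 + w.2 ^ 2 < R := by
    rw [← sqrt_sqMap]
    exact hφ (subset_tsupport φ hw)
  rw [mem_closedBall_zero_iff, Prod.norm_def]
  exact max_le (Real.abs_le_sqrt (by nlinarith [sq_nonneg w.2]))
    (Real.abs_le_sqrt (by nlinarith [sq_nonneg w.1]))

lemma setIntegral_fderiv_snd_eq_zero {g : ℝ × ℝ → ℝ} (hg : ContDiff ℝ 1 g)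
    (hc : HasCompactSupport g) (s : Set ℝ) :
    ∫ w in s ×ˢ (univ : Set ℝ), fderiv ℝ g w (0, 1) = 0 := by
  have hcont : Continuous fun w => fderiv ℝ g w (0, 1) :=
    (hg.continuous_fderiv one_ne_zero).clm_apply continuous_const
  have hc' : HasCompactSupport fun w => fderiv ℝ g w (0, 1) := hc.fderiv_apply ℝ _
  have slice (u : ℝ) : Topology.IsClosedEmbedding fun v : ℝ => (u, v) :=
    (Isometry.of_dist_eq fun v v' => by simp [Prod.dist_eq]).isClosedEmbedding
  rw [Measure.volume_eq_prod,
    setIntegral_prod _ (hcont.integrable_of_hasCompactSupport hc').integrableOn]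
  refine integral_eq_zero_of_ae (Filter.Eventually.of_forall fun u => ?_)
  simp only [setIntegral_univ, Pi.zero_apply]
  refine integral_eq_zero_of_hasDerivAt_of_integrable (f := fun v => g (u, v)) (fun v => ?_)
    ((hcont.comp (slice u).continuous).integrable_of_hasCompactSupport
      (hc'.comp_isClosedEmbedding (slice u)))
    ((hg.continuous.comp (slice u).continuous).integrable_of_hasCompactSupport
      (hc.comp_isClosedEmbedding (slice u)))
  exact (hg.differentiable one_ne_zero (u, v)).hasFDerivAt.comp_hasDerivAt v
    ((hasDerivAt_const v u).prodMk (hasDerivAt_id v))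

/-- `S` is a weak solution of the Laplace equation with homogeneous Neumann condition
on the crack: for every `R > 0` and every smooth compactly supported test function `φ`
with support in `B_R` (not required to vanish on the crack),
`∫_{B_R \ crack} ∇S · ∇φ dx = 0`. -/
theorem S_weak_solution :
    ∀ R : ℝ, 0 < R → ∀ φ : ℝ × ℝ → ℝ, ContDiff ℝ (⊤ : ℕ∞) φ → HasCompactSupport φ →
      tsupport φ ⊆ ball R →
      ∫ x in ball R \ crack,
        (fderiv ℝ S x (1, 0) * fderiv ℝ φ x (1, 0) +
         fderiv ℝ S x (0, 1) * fderiv ℝ φ x (0, 1)) = 0 := by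
  intro R _ φ hφ _ hsupp
  have hcrack : MeasurableSet crack :=
    (measurableSet_eq_fun measurable_snd measurable_const).inter
      (measurableSet_le measurable_fst measurable_const)
  have hsub : ball R \ crack ⊆ crackᶜ := fun _ hx => hx.2
  rw [← setIntegral_eq_of_subset_of_forall_sdiff_eq_zero hcrack.compl hsub ?_, ← image_sqMap,
    integral_image_eq_integral_abs_det_fderiv_smul volume
      (measurableSet_Ioi.prod MeasurableSet.univ)
      (fun w _ => (hasFDerivAt_sqMap w).hasFDerivWithinAt) injOn_sqMap,
    setIntegral_congr_fun (g := fun w => fderiv ℝ (φ ∘ sqMap) w (0, 1))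
      (measurableSet_Ioi.prod MeasurableSet.univ) fun w hw =>
        det_mul_gradient_product hw.1 (hφ.differentiable (by simp) _)]
  · exact setIntegral_fderiv_snd_eq_zero ((hφ.comp contDiff_sqMap).of_le (by norm_cast))
      (hasCompactSupport_comp_sqMap hsupp) _
  · rintro x ⟨hx, hx'⟩
    have : x ∉ tsupport φ := fun h => hx' ⟨hsupp h, hx⟩
    simp [image_eq_zero_of_notMem_tsupport fun h => this (tsupport_fderiv_subset ℝ h)]
end

section
/- The function $u$ solves the wave equation on the time-dependent cracked domain: for every $t\in[0,T]$ and every $x\in\Omega\setminus\Gamma_t$, all first and second partial derivatives of $u$ with respect to $t$, $x_1$, $x_2$ exist at $(t,x)$ and $\partial_{tt}u(t,x)=\partial_{11}u(t,x)+\partial_{22}u(t,x)$. -/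
/-- The open ball `Ω = {|x| < R}`. -/
def Omega (R : ℝ) : Set (ℝ × ℝ) := {x | Real.sqrt (x.1 ^ 2 + x.2 ^ 2) < R}

/-- The crack at time `t`: `Γ_t = {(σ,0) ∈ Ω̄ : σ ≤ ct}`. -/
def Crack (R c t : ℝ) : Set (ℝ × ℝ) :=
  {x | Real.sqrt (x.1 ^ 2 + x.2 ^ 2) ≤ R ∧ x.2 = 0 ∧ x.1 ≤ c * t}

/-- `u(t,x) = (2/√π) S((x₁ - ct)/√(1-c²), x₂)`, as a function of `(t, x₁, x₂)`. -/
noncomputable def U (c : ℝ) : ℝ × ℝ × ℝ → ℝ := fun p =>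
  (2 / Real.sqrt Real.pi) * S ((p.2.1 - c * p.1) / Real.sqrt (1 - c ^ 2), p.2.2)

open Filter Topology

/-- The chain rule for the imaginary part of a holomorphic function precomposed with a
real-linear map. -/
theorem hasFDerivAt_im_comp_clm {E : Type*} [NormedAddCommGroup E] [NormedSpace ℝ E]
    {f : ℂ → ℂ} {f' : ℂ} (L : E →L[ℝ] ℂ) {p : E} (hf : HasDerivAt f f' (L p)) :
    HasFDerivAt (fun q => (f (L q)).im) (Complex.imCLM ∘L (f' • L)) p := by
  have h := hf.comp_hasFDerivAt_of_eq p L.hasFDerivAt rfl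
  exact Complex.imCLM.hasFDerivAt.comp p h

/-- The second derivative of the imaginary part of a holomorphic function precomposed with a
real-linear map. -/
theorem fderiv_fderiv_im_comp_clm {E : Type*} [NormedAddCommGroup E] [NormedSpace ℝ E]
    {f : ℂ → ℂ} (L : E →L[ℝ] ℂ) {p : E} (hf : AnalyticAt ℂ f (L p)) :
    DifferentiableAt ℝ (fun q => (f (L q)).im) p ∧
    DifferentiableAt ℝ (fderiv ℝ fun q => (f (L q)).im) p ∧
    ∀ v w, fderiv ℝ (fderiv ℝ fun q => (f (L q)).im) p v w =
      (deriv (deriv f) (L p) * L v * L w).im := by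
  have hev : ∀ᶠ q in 𝓝 p, fderiv ℝ (fun q => (f (L q)).im) q =
      Complex.imCLM ∘L (deriv f (L q) • L) := by
    filter_upwards [L.continuous.continuousAt.eventually hf.eventually_analyticAt] with q hq
    exact (hasFDerivAt_im_comp_clm L hq.differentiableAt.hasDerivAt).fderiv
  have hC : ContDiffAt ℝ 2 (fun q => (f (L q)).im) p := by
    have h1 : ContDiffAt ℝ 2 f (L p) := (hf.restrictScalars (𝕜 := ℝ)).contDiffAt
    exact Complex.imCLM.contDiff.contDiffAt.comp p (h1.comp p L.contDiff.contDiffAt)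
  have hD : DifferentiableAt ℝ (fderiv ℝ fun q => (f (L q)).im) p :=
    (hC.fderiv_right (m := 1) (by norm_num)).differentiableAt (by norm_num)
  refine ⟨hC.differentiableAt (by norm_num), hD, fun v w => ?_⟩
  have h1 : fderiv ℝ (fun q => fderiv ℝ (fun q => (f (L q)).im) q w) p v =
      fderiv ℝ (fderiv ℝ fun q => (f (L q)).im) p v w := by
    rw [fderiv_clm_apply hD (differentiableAt_const w)]
    simp
  have h2 : (fun q => fderiv ℝ (fun q => (f (L q)).im) q w) =ᶠ[𝓝 p]
      fun q => (deriv f (L q) * L w).im := by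
    filter_upwards [hev] with q hq
    simp [hq]
  have h3 := hasFDerivAt_im_comp_clm (f := fun z => deriv f z * L w) L
    (hf.deriv.differentiableAt.hasDerivAt.mul_const (L w))
  rw [← h1, h2.fderiv_eq, h3.fderiv]
  change (deriv (deriv f) (L p) * L w * L v).im = _
  congr 1
  ring

/-- On the slit plane, `S` is the imaginary part of the principal square root. -/
theorem S_eq_im_cpow {z : ℂ} (hz : z ∈ Complex.slitPlane) :
    S (z.re, z.im) = (z ^ (2⁻¹ : ℂ)).im := by
  have hsq : (z ^ (2⁻¹ : ℂ)) ^ 2 = z := Complex.cpow_nat_inv_pow z two_ne_zero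
  have hre : (z ^ (2⁻¹ : ℂ)).re = √((‖z‖ + z.re) / 2) := Complex.cpow_inv_two_re z
  have hpos : 0 < ‖z‖ + z.re := by
    rcases hz with h | h
    · positivity
    · have := Complex.abs_re_lt_norm.2 h
      linarith [neg_abs_le z.re]
  have him : 2 * ((z ^ (2⁻¹ : ℂ)).re * (z ^ (2⁻¹ : ℂ)).im) = z.im := by
    conv_rhs => rw [← hsq, pow_two, Complex.mul_im]
    ring
  have hn : √(z.re ^ 2 + z.im ^ 2) = ‖z‖ := by
    rw [Complex.norm_def, Complex.normSq_apply, pow_two, pow_two]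
  rw [hre, Real.sqrt_div hpos.le] at him
  have h2 : √(2 : ℝ) ^ 2 = 2 := Real.sq_sqrt (by norm_num)
  have hs2 : 0 < √(2 : ℝ) := by positivity
  have hs : 0 < √(‖z‖ + z.re) := Real.sqrt_pos.2 hpos
  simp only [S, hn]
  rw [← him]
  generalize (z ^ (2⁻¹ : ℂ)).im = y
  field_simp
  linear_combination -y * h2

/-- The Lorentz-boosted spatial variable, as a complex number depending linearly on
`(t, x₁, x₂)`. -/
noncomputable def boost (c : ℝ) : ℝ × ℝ × ℝ →L[ℝ] ℂ :=
  Complex.equivRealProdCLM.symm.toContinuousLinearMap ∘L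
    (((√(1 - c ^ 2))⁻¹ • (ContinuousLinearMap.fst ℝ ℝ ℝ ∘L ContinuousLinearMap.snd ℝ ℝ (ℝ × ℝ) -
      c • ContinuousLinearMap.fst ℝ ℝ (ℝ × ℝ))).prod
    (ContinuousLinearMap.snd ℝ ℝ ℝ ∘L ContinuousLinearMap.snd ℝ ℝ (ℝ × ℝ)))

theorem boost_re (c : ℝ) (p : ℝ × ℝ × ℝ) :
    (boost c p).re = (p.2.1 - c * p.1) / √(1 - c ^ 2) := by
  simp [boost, div_eq_inv_mul]

theorem boost_im (c : ℝ) (p : ℝ × ℝ × ℝ) : (boost c p).im = p.2.2 := by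
  simp [boost]

theorem boost_null {c : ℝ} (hc : c ^ 2 < 1) :
    boost c (1, 0, 0) ^ 2 = boost c (0, 1, 0) ^ 2 + boost c (0, 0, 1) ^ 2 := by
  have hs : √(1 - c ^ 2) ^ 2 = 1 - c ^ 2 := Real.sq_sqrt (by linarith)
  have hs0 : √(1 - c ^ 2) ≠ 0 := (Real.sqrt_pos.2 (by linarith)).ne'
  apply Complex.ext
  · simp only [pow_two, Complex.mul_re, Complex.add_re, boost_re, boost_im]
    simp only [← pow_two]
    field_simp
    rw [hs]
    ring
  · simp [pow_two, boost_re, boost_im]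

/-- `u` solves the wave equation on the time-dependent cracked domain: for every
`t ∈ [0,T]` and `x ∈ Ω \ Γ_t`, all first and second partial derivatives of `u` in
`(t,x₁,x₂)` exist (here: `u` is twice Fréchet differentiable at `(t,x)`) and
`∂ₜₜu = ∂₁₁u + ∂₂₂u`. -/
theorem u_solves_wave_equation (c T R : ℝ) (hc0 : 0 < c) (hc1 : c < 1) (hT : 0 < T)
    (hR : c * T < R) :
    ∀ t ∈ Set.Icc (0 : ℝ) T, ∀ x ∈ Omega R \ Crack R c t,
      DifferentiableAt ℝ (U c) (t, x) ∧
      DifferentiableAt ℝ (fderiv ℝ (U c)) (t, x) ∧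
      fderiv ℝ (fderiv ℝ (U c)) (t, x) (1, 0, 0) (1, 0, 0) =
        fderiv ℝ (fderiv ℝ (U c)) (t, x) (0, 1, 0) (0, 1, 0) +
        fderiv ℝ (fderiv ℝ (U c)) (t, x) (0, 0, 1) (0, 0, 1) := by
  intro t _ x ⟨hxR, hxC⟩
  have hc : c ^ 2 < 1 := by nlinarith
  have hs : 0 < √(1 - c ^ 2) := Real.sqrt_pos.2 (by linarith)
  have hz : boost c (t, x) ∈ Complex.slitPlane := by
    rw [Complex.mem_slitPlane_iff, boost_re, boost_im]
    by_contra! h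
    refine hxC ⟨le_of_lt hxR, h.2, ?_⟩
    by_contra! hx
    exact absurd h.1 (not_le.2 (div_pos (sub_pos.2 hx) hs))
  set f : ℂ → ℂ := fun z => ((2 / √Real.pi : ℝ) : ℂ) * z ^ (2⁻¹ : ℂ) with hf
  have hfa : AnalyticAt ℂ f (boost c (t, x)) :=
    analyticAt_const.mul (analyticAt_id.cpow analyticAt_const hz)
  have hU : U c =ᶠ[𝓝 (t, x)] fun q => (f (boost c q)).im := by
    filter_upwards [(boost c).continuous.continuousAt.eventually
      (Complex.isOpen_slitPlane.mem_nhds hz)] with q hq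
    have := S_eq_im_cpow hq
    rw [boost_re, boost_im] at this
    simp only [U, hf, Complex.im_ofReal_mul, this]
  obtain ⟨h1, h2, h3⟩ := fderiv_fderiv_im_comp_clm (boost c) hfa
  refine ⟨h1.congr_of_eventuallyEq hU, h2.congr_of_eventuallyEq hU.fderiv, ?_⟩
  rw [hU.fderiv.fderiv_eq, h3, h3, h3, ← Complex.add_im]
  congr 1
  linear_combination deriv (deriv f) (boost c (t, x)) * boost_null hc
end

section
/- The displacement $u$ satisfies the homogeneous Neumann condition on both faces of the moving crack: for every $t\in[0,T]$ and every $x_1$ with $-R<x_1<ct$, one has $\lim_{h\to 0^+}\partial_{x_2}u(t,x_1,h)=0$ and $\lim_{h\to 0^-}\partial_{x_2}u(t,x_1,h)=0$. -/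
open Filter

/-- `u(t,x) = (2/√π) S((x₁ - ct)/√(1-c²), x₂)`. -/
noncomputable def u (c t : ℝ) : ℝ × ℝ → ℝ := fun x =>
  (2 / Real.sqrt Real.pi) * S ((x.1 - c * t) / Real.sqrt (1 - c ^ 2), x.2)

/-- On the left half-plane `S` is, up to the sign of the second variable, the smooth function
`√(|x| - x₁) / √2`. -/
lemma S_eq_of_neg {a : ℝ} (ha : a < 0) (s : ℝ) :
    S (a, s) = Real.sign s * (1 / √2) * √(√(a ^ 2 + s ^ 2) - a) := by
  rcases eq_or_ne s 0 with rfl | hs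
  · simp [S]
  have hr : √(a ^ 2 + s ^ 2) ^ 2 = a ^ 2 + s ^ 2 := Real.sq_sqrt (by positivity)
  have hminus : 0 < √(a ^ 2 + s ^ 2) - a := by linarith [Real.sqrt_nonneg (a ^ 2 + s ^ 2)]
  have hs2 : 0 < s ^ 2 := by positivity
  have hplus : 0 < √(a ^ 2 + s ^ 2) + a := by
    by_contra! h
    nlinarith
  have hprod : √(√(a ^ 2 + s ^ 2) - a) * √(√(a ^ 2 + s ^ 2) + a) = |s| := by
    rw [← Real.sqrt_mul hminus.le, ← Real.sqrt_sq_eq_abs]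
    congr 1
    linear_combination hr
  have hsign : s = Real.sign s * |s| := by
    rcases hs.lt_or_gt with h | h
    · simp [Real.sign_of_neg h, abs_of_neg h]
    · simp [Real.sign_of_pos h, abs_of_pos h]
  have hne : √(√(a ^ 2 + s ^ 2) + a) ≠ 0 := (Real.sqrt_pos.2 hplus).ne'
  have hdiv : s / √(√(a ^ 2 + s ^ 2) + a) = Real.sign s * √(√(a ^ 2 + s ^ 2) - a) := by
    rw [div_eq_iff hne, mul_assoc, hprod]
    exact hsign
  simp only [S]
  rw [hdiv]
  ring

lemma hasDerivAt_sqrt_norm_sub {a : ℝ} (ha : a < 0) (s : ℝ) :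
    HasDerivAt (fun s : ℝ => √(√(a ^ 2 + s ^ 2) - a))
      (s / √(a ^ 2 + s ^ 2) / (2 * √(√(a ^ 2 + s ^ 2) - a))) s := by
  have hr : a ^ 2 + s ^ 2 ≠ 0 := by have := ha.ne; positivity
  have hminus : 0 < √(a ^ 2 + s ^ 2) - a := by
    linarith [Real.sqrt_nonneg (a ^ 2 + s ^ 2)]
  have hsq : HasDerivAt (fun s : ℝ => a ^ 2 + s ^ 2) (2 * s) s := by
    simpa using (hasDerivAt_pow 2 s).const_add (a ^ 2)
  convert ((hsq.sqrt hr).sub_const a).sqrt hminus.ne' using 2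
  rw [mul_div_mul_left _ _ two_ne_zero]

/-- If `f` agrees with a multiple of `√(|(a, s)| - a)` on an open set `U`, then its derivative
tends to zero at `0` within `U`. -/
lemma tendsto_deriv_of_eqOn_sqrt_norm_sub {a : ℝ} (ha : a < 0) {f : ℝ → ℝ} {k : ℝ} {U : Set ℝ}
    (hU : IsOpen U) (hf : Set.EqOn f (fun s => k * √(√(a ^ 2 + s ^ 2) - a)) U) :
    Tendsto (deriv f) (nhdsWithin 0 U) (nhds 0) := by
  have hderiv : ∀ h ∈ U, deriv f h =
      k * (h / √(a ^ 2 + h ^ 2) / (2 * √(√(a ^ 2 + h ^ 2) - a))) := fun h hh =>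
    (((hasDerivAt_sqrt_norm_sub ha h).const_mul k).congr_of_eventuallyEq
      (hf.eventuallyEq_of_mem (hU.mem_nhds hh))).deriv
  have hcont : ContinuousAt
      (fun h : ℝ => k * (h / √(a ^ 2 + h ^ 2) / (2 * √(√(a ^ 2 + h ^ 2) - a)))) 0 := by
    have hr : √(a ^ 2 + (0 : ℝ) ^ 2) ≠ 0 := by have := ha.ne; positivity
    have hminus : 0 < √(a ^ 2 + (0 : ℝ) ^ 2) - a := by
      linarith [Real.sqrt_nonneg (a ^ 2 + (0 : ℝ) ^ 2)]
    have hden : 2 * √(√(a ^ 2 + (0 : ℝ) ^ 2) - a) ≠ 0 :=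
      mul_ne_zero two_ne_zero (Real.sqrt_pos.2 hminus).ne'
    fun_prop (disch := assumption)
  have hlim := hcont.tendsto
  simp only [zero_div, mul_zero] at hlim
  exact (hlim.mono_left nhdsWithin_le_nhds).congr'
    (eventually_nhdsWithin_of_forall fun h hh => (hderiv h hh).symm)

/-- Homogeneous Neumann condition on both faces of the moving crack: for every
`t ∈ [0,T]` and every `x₁` with `-R < x₁ < ct`, `∂_{x₂}u(t,x₁,h) → 0` as `h → 0⁺`
and as `h → 0⁻`. -/
theorem u_neumann_on_crack (c T R : ℝ) (hc0 : 0 < c) (hc1 : c < 1) (hT : 0 < T)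
    (hR : c * T < R) :
    ∀ t ∈ Set.Icc (0 : ℝ) T, ∀ x₁ : ℝ, -R < x₁ → x₁ < c * t →
      Tendsto (fun h : ℝ => deriv (fun s : ℝ => u c t (x₁, s)) h)
        (nhdsWithin 0 (Set.Ioi 0)) (nhds 0) ∧
      Tendsto (fun h : ℝ => deriv (fun s : ℝ => u c t (x₁, s)) h)
        (nhdsWithin 0 (Set.Iio 0)) (nhds 0) := by
  intro t _ x₁ _ hx
  have ha : (x₁ - c * t) / √(1 - c ^ 2) < 0 :=
    div_neg_of_neg_of_pos (by linarith) (Real.sqrt_pos.2 (by nlinarith))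
  constructor
  · refine tendsto_deriv_of_eqOn_sqrt_norm_sub ha (k := 2 / √Real.pi * (1 / √2)) isOpen_Ioi ?_
    intro s hs
    simp only [u, S_eq_of_neg ha, Real.sign_of_pos (Set.mem_Ioi.1 hs)]
    ring
  · refine tendsto_deriv_of_eqOn_sqrt_norm_sub ha (k := -(2 / √Real.pi * (1 / √2))) isOpen_Iio ?_
    intro s hs
    simp only [u, S_eq_of_neg ha, Real.sign_of_neg (Set.mem_Iio.1 hs)]
    ring
end

section
/- The velocity field $\partial_t u$ also satisfies the homogeneous Neumann condition on both faces of the moving crack: for every $t\in[0,T]$ and every $x_1$ with $-R<x_1<ct$, one has $\lim_{h\to 0^+}\partial_{x_2}\partial_t u(t,x_1,h)=0$ and $\lim_{h\to 0^-}\partial_{x_2}\partial_t u(t,x_1,h)=0$. -/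
open Filter

open Topology

lemma abs_lt_sqrt_sq_add_sq (y : ℝ) {s : ℝ} (hs : s ≠ 0) : |y| < √(y ^ 2 + s ^ 2) := by
  rw [← Real.sqrt_sq_eq_abs]
  exact Real.sqrt_lt_sqrt (sq_nonneg y) (lt_add_of_pos_right _ (by positivity))

/-- The conjugate form of `S`, free of the vanishing denominator behind the crack tip. -/
lemma S_eq_sign_mul_sqrt (y : ℝ) {s : ℝ} (hs : s ≠ 0) :
    S (y, s) = s.sign * √((√(y ^ 2 + s ^ 2) - y) / 2) := by
  have hr := abs_lt_sqrt_sq_add_sq y hs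
  obtain ⟨hr₁, hr₂⟩ := abs_lt.mp hr
  have hsq : √(y ^ 2 + s ^ 2) ^ 2 = y ^ 2 + s ^ 2 := Real.sq_sqrt (by positivity)
  simp only [S]
  generalize √(y ^ 2 + s ^ 2) = r at *
  have ha : 0 < √(r + y) := Real.sqrt_pos.mpr (by linarith)
  have hab : √(r + y) * √(r - y) = |s| := by
    rw [← Real.sqrt_mul (by linarith), ← Real.sqrt_sq_eq_abs]
    congr 1
    linarith
  have hsign : s.sign * |s| = s := by
    rcases hs.lt_or_gt with h | h
    · simp [Real.sign_of_neg h, abs_of_neg h]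
    · simp [Real.sign_of_pos h, abs_of_pos h]
  rw [Real.sqrt_div (by linarith)]
  field_simp
  rw [mul_assoc, mul_left_comm, hab, hsign]

lemma hasDerivAt_S_fst (y : ℝ) {s : ℝ} (hs : s ≠ 0) :
    HasDerivAt (fun z : ℝ => S (z, s))
      (-(s.sign * √((√(y ^ 2 + s ^ 2) - y) / 2)) / (2 * √(y ^ 2 + s ^ 2))) y := by
  have hr := abs_lt_sqrt_sq_add_sq y hs
  have hr₀ : 0 < √(y ^ 2 + s ^ 2) := (abs_nonneg y).trans_lt hr
  have hpos : 0 < (√(y ^ 2 + s ^ 2) - y) / 2 := by linarith [(abs_lt.mp hr).2]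
  have hrad : HasDerivAt (fun z : ℝ => √(z ^ 2 + s ^ 2)) _ y :=
    (((hasDerivAt_id y).pow 2).add_const (s ^ 2)).sqrt (by simp only [id, Pi.pow_apply]; positivity)
  have h := (((hrad.sub (hasDerivAt_id y)).div_const 2).sqrt hpos.ne').const_mul s.sign
  have hS : (fun z : ℝ => S (z, s)) = fun z => s.sign * √((√(z ^ 2 + s ^ 2) - z) / 2) :=
    funext fun z => S_eq_sign_mul_sqrt z hs
  rw [hS]
  refine h.congr_deriv ?_
  simp only [id, Pi.sub_apply, Pi.pow_apply]
  have hq : √((√(y ^ 2 + s ^ 2) - y) / 2) ^ 2 = (√(y ^ 2 + s ^ 2) - y) / 2 :=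
    Real.sq_sqrt hpos.le
  have hq₀ : 0 < √((√(y ^ 2 + s ^ 2) - y) / 2) := Real.sqrt_pos.mpr hpos
  generalize √((√(y ^ 2 + s ^ 2) - y) / 2) = q at *
  generalize √(y ^ 2 + s ^ 2) = r at *
  norm_num
  field_simp
  rw [hq]
  ring

lemma deriv_u_time (c t x : ℝ) {s : ℝ} (hs : s ≠ 0) :
    deriv (fun τ : ℝ => u c τ (x, s)) t =
      c / (√Real.pi * √(1 - c ^ 2)) * s.sign *
        (√((√(((x - c * t) / √(1 - c ^ 2)) ^ 2 + s ^ 2) - (x - c * t) / √(1 - c ^ 2)) / 2) /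
          √(((x - c * t) / √(1 - c ^ 2)) ^ 2 + s ^ 2)) := by
  have hy : HasDerivAt (fun τ : ℝ => (x - c * τ) / √(1 - c ^ 2)) (-(c * 1) / √(1 - c ^ 2)) t :=
    (((hasDerivAt_id t).const_mul c).const_sub x).div_const _
  have h := ((hasDerivAt_S_fst ((x - c * t) / √(1 - c ^ 2)) hs).comp t hy).const_mul
    (2 / √Real.pi)
  refine h.deriv.trans ?_
  simp only [div_eq_mul_inv, mul_inv]
  ring

/-- Behind the crack tip (`y < 0`), the transverse profile of the velocity is even and
continuously differentiable. -/
lemma tendsto_deriv_profile {y : ℝ} (hy : y < 0) :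
    Tendsto (deriv fun s : ℝ => √((√(y ^ 2 + s ^ 2) - y) / 2) / √(y ^ 2 + s ^ 2))
      (𝓝 0) (𝓝 0) := by
  have hy₀ : y ≠ 0 := hy.ne
  have hr₀ (s : ℝ) : 0 < √(y ^ 2 + s ^ 2) :=
    Real.sqrt_pos.mpr (add_pos_of_pos_of_nonneg (by positivity) (sq_nonneg s))
  have hf : ContDiff ℝ 1 fun s : ℝ => √((√(y ^ 2 + s ^ 2) - y) / 2) / √(y ^ 2 + s ^ 2) := by
    have hr : ContDiff ℝ 1 fun s : ℝ => √(y ^ 2 + s ^ 2) :=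
      ContDiff.sqrt (by fun_prop) fun s => (Real.sqrt_pos.mp (hr₀ s)).ne'
    exact (((hr.sub contDiff_const).div_const 2).sqrt fun s => by
      have := hr₀ s
      linarith).div hr fun s => (hr₀ s).ne'
  have h := (hf.continuous_deriv le_rfl).tendsto 0
  have h₀ : deriv (fun s : ℝ => √((√(y ^ 2 + s ^ 2) - y) / 2) / √(y ^ 2 + s ^ 2)) 0 = 0 := by
    have := deriv_comp_neg
      (fun s : ℝ => √((√(y ^ 2 + s ^ 2) - y) / 2) / √(y ^ 2 + s ^ 2)) 0
    simp only [neg_sq, neg_zero] at this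
    linarith
  rwa [h₀] at h

/-- The velocity `∂ₜu` satisfies the homogeneous Neumann condition on both faces of
the moving crack: for every `t ∈ [0,T]` and every `x₁` with `-R < x₁ < ct`,
`∂_{x₂}∂ₜu(t,x₁,h) → 0` as `h → 0⁺` and as `h → 0⁻`. -/
theorem ut_neumann_on_crack (c T R : ℝ) (hc0 : 0 < c) (hc1 : c < 1) (hT : 0 < T)
    (hR : c * T < R) :
    ∀ t ∈ Set.Icc (0 : ℝ) T, ∀ x₁ : ℝ, -R < x₁ → x₁ < c * t →
      Tendsto (fun h : ℝ => deriv (fun s : ℝ => deriv (fun τ : ℝ => u c τ (x₁, s)) t) h)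
        (nhdsWithin 0 (Set.Ioi 0)) (nhds 0) ∧
      Tendsto (fun h : ℝ => deriv (fun s : ℝ => deriv (fun τ : ℝ => u c τ (x₁, s)) t) h)
        (nhdsWithin 0 (Set.Iio 0)) (nhds 0) := by
  intro t _ x₁ _ hx
  have hy : (x₁ - c * t) / √(1 - c ^ 2) < 0 :=
    div_neg_of_neg_of_pos (by linarith) (Real.sqrt_pos.mpr (by nlinarith))
  have key (A : Set ℝ) (hA : IsOpen A) (σ : ℝ) (hσ : ∀ s ∈ A, s ≠ 0 ∧ s.sign = σ) :
      Tendsto (fun h : ℝ => deriv (fun s : ℝ => deriv (fun τ : ℝ => u c τ (x₁, s)) t) h)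
        (𝓝[A] 0) (𝓝 0) := by
    have h := ((tendsto_deriv_profile hy).mono_left (nhdsWithin_le_nhds (s := A))).const_mul
      (c / (√Real.pi * √(1 - c ^ 2)) * σ)
    rw [mul_zero] at h
    refine h.congr' ?_
    filter_upwards [self_mem_nhdsWithin] with s hs
    rw [← deriv_const_mul_field]
    refine Filter.EventuallyEq.deriv_eq ?_
    filter_upwards [hA.mem_nhds hs] with z hz
    rw [deriv_u_time c t x₁ (hσ z hz).1, (hσ z hz).2]
  exact ⟨key _ isOpen_Ioi 1 fun s hs => ⟨ne_of_gt hs, Real.sign_of_pos hs⟩,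
    key _ isOpen_Iio (-1) fun s hs => ⟨ne_of_lt hs, Real.sign_of_neg hs⟩⟩
end
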